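/- For every associative, not necessarily unital, ℂ-algebra A and every n ≥ 0, one has on Ωⁿ A: κ^{n(n+1)} − id = b ∘ B = −B ∘ b. Moreover B ∘ B = 0, B ∘ b + b ∘ B = κ^{n(n+1)} − id on Ωⁿ A composes to give (B + b)² = 0 on Ω A; thus (Ω A, b, B) is a bicomplex. -/

import Mathlib

open scoped TensorProduct

/-- The differential graded algebra `Ω A` of noncommutative differential forms over the
(not necessarily unital) `ℂ`-algebra `A`, presented through its canonical structure:
a (non-unital) `ℂ`-algebra graded by subspaces `deg n` (with `deg n` corresponding to
`Ωⁿ A = Ã ⊗ A^{⊗n}`), `Ω⁰ A = A` embedded via the injective algebra map `ι`, the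
differential `d` with `d ∘ d = 0` and the graded Leibniz rule, the defining recursion
`(d a)·y = d (a·y) − a·(d y)` for `a, y ∈ A`, and every `Ω^{n+1} A` spanned by the
elementary forms `ã₀ da₁ ⋯ da_{n+1}`. -/
structure Forms (A : Type) [NonUnitalRing A] [Module ℂ A]
    [SMulCommClass ℂ A A] [IsScalarTower ℂ A A] : Type 1 where
  Ω : Type
  [ringΩ : NonUnitalRing Ω]
  [modΩ : Module ℂ Ω]
  [smulCommΩ : SMulCommClass ℂ Ω Ω]
  [towerΩ : IsScalarTower ℂ Ω Ω]
  deg : ℕ → Submodule ℂ Ω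
  internal : DirectSum.IsInternal deg
  mul_mem' : ∀ {m n : ℕ} {x y : Ω}, x ∈ deg m → y ∈ deg n → x * y ∈ deg (m + n)
  ι : A →ₗ[ℂ] Ω
  ι_injective : Function.Injective ι
  ι_mul : ∀ a b : A, ι (a * b) = ι a * ι b
  deg_zero : deg 0 = LinearMap.range ι
  d : Ω →ₗ[ℂ] Ω
  d_mem : ∀ {n : ℕ} {x : Ω}, x ∈ deg n → d x ∈ deg (n + 1)
  d_d : ∀ x : Ω, d (d x) = 0
  leibniz : ∀ {n : ℕ} {x : Ω}, x ∈ deg n → ∀ y : Ω,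
    d (x * y) = d x * y + ((-1 : ℂ) ^ n) • (x * d y)
  da_mul : ∀ a y : A, d (ι a) * ι y = d (ι (a * y)) - ι a * d (ι y)
  deg_one : deg 1 = Submodule.span ℂ
    ({x | ∃ a : A, x = d (ι a)} ∪ {x | ∃ a b : A, x = ι a * d (ι b)})
  deg_succ : ∀ n : ℕ, deg (n + 2) =
    Submodule.span ℂ {x | ∃ ω ∈ deg (n + 1), ∃ a : A, x = ω * d (ι a)}

attribute [instance] Forms.ringΩ Forms.modΩ Forms.smulCommΩ Forms.towerΩ

namespace Forms

variable {A : Type} [NonUnitalRing A] [Module ℂ A] [SMulCommClass ℂ A A] [IsScalarTower ℂ A A]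

/-- The word `d a₁ ⋯ d aₙ`, as an element of the unitization of `Ω A` (the empty word
being the adjoined unit). -/
noncomputable def wordU (F : Forms A) (l : List A) : Unitization ℂ F.Ω :=
  (l.map fun a => (Unitization.inr (F.d (F.ι a)) : Unitization ℂ F.Ω)).prod

/-- The word `d a₁ d b₁ ⋯ d aₙ d bₙ` of even length, as an element of the unitization
of `Ω A`. -/
noncomputable def wordU2 (F : Forms A) (l : List (A × A)) : Unitization ℂ F.Ω :=
  (l.map fun q => (Unitization.inr (F.d (F.ι q.1) * F.d (F.ι q.2)) : Unitization ℂ F.Ω)).prod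

/-- The even part `Ω^{even} A = ⊕ₙ Ω^{2n} A`; endowed with the Fedosov product
`x ⊙ y = x·y − dx·dy` it is the tensor algebra `T A`. -/
def evenPart (F : Forms A) : Submodule ℂ F.Ω := ⨆ n : ℕ, F.deg (2 * n)

end Forms

namespace Forms

variable {A : Type} [NonUnitalRing A] [Module ℂ A] [SMulCommClass ℂ A A] [IsScalarTower ℂ A A]

/-- `F.IsWord n w` says that `w` is a product `d a₁ ⋯ d aₙ` of `n ≥ 1` exact one-forms. -/
inductive IsWord (F : Forms A) : ℕ → F.Ω → Prop
  | single (a : A) : IsWord F 1 (F.d (F.ι a))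
  | snoc {n : ℕ} {w : F.Ω} (hw : IsWord F n w) (a : A) : IsWord F (n + 1) (w * F.d (F.ι a))

variable {F : Forms A}

lemma ι_mem (F : Forms A) (a : A) : F.ι a ∈ F.deg 0 := by
  rw [F.deg_zero]
  exact ⟨a, rfl⟩

lemma dι_mem (F : Forms A) (a : A) : F.d (F.ι a) ∈ F.deg 1 := F.d_mem (F.ι_mem a)

lemma ι_mul_mem {n : ℕ} {x : F.Ω} (hx : x ∈ F.deg n) (a : A) : F.ι a * x ∈ F.deg n := by
  simpa using F.mul_mem' (F.ι_mem a) hx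

lemma mul_ι_mem {n : ℕ} {x : F.Ω} (hx : x ∈ F.deg n) (a : A) : x * F.ι a ∈ F.deg n :=
  F.mul_mem' hx (F.ι_mem a)

lemma mul_dι_mem {n : ℕ} {x : F.Ω} (hx : x ∈ F.deg n) (a : A) :
    x * F.d (F.ι a) ∈ F.deg (n + 1) :=
  F.mul_mem' hx (F.dι_mem a)

lemma dι_mul_mem {n : ℕ} {x : F.Ω} (hx : x ∈ F.deg n) (a : A) :
    F.d (F.ι a) * x ∈ F.deg (n + 1) := by
  simpa [add_comm] using F.mul_mem' (F.dι_mem a) hx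

lemma IsWord.mem_deg {n : ℕ} {w : F.Ω} (hw : F.IsWord n w) : w ∈ F.deg n := by
  induction hw with
  | single a => exact F.dι_mem a
  | snoc _ a ih => exact mul_dι_mem ih a

lemma d_mul_dι {n : ℕ} {x : F.Ω} (hx : x ∈ F.deg n) (a : A) :
    F.d (x * F.d (F.ι a)) = F.d x * F.d (F.ι a) := by
  rw [F.leibniz hx, F.d_d]
  simp

lemma IsWord.d_eq_zero {n : ℕ} {w : F.Ω} (hw : F.IsWord n w) : F.d w = 0 := by
  induction hw with
  | single a => exact F.d_d _
  | snoc hw a ih => rw [d_mul_dι hw.mem_deg, ih, zero_mul]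

lemma IsWord.dι_mul {n : ℕ} {w : F.Ω} (hw : F.IsWord n w) (a : A) :
    F.IsWord (n + 1) (F.d (F.ι a) * w) := by
  induction hw with
  | single c => exact (IsWord.single a).snoc c
  | snoc _ c ih =>
    rw [← mul_assoc]
    exact ih.snoc c

lemma d_ι_mul_word {n : ℕ} {w : F.Ω} (hw : F.IsWord n w) (a : A) :
    F.d (F.ι a * w) = F.d (F.ι a) * w := by
  rw [F.leibniz (F.ι_mem a), hw.d_eq_zero]
  simp

/-- A linear map vanishing on exact one-forms and on all `ω da` vanishes in positive degree. -/
lemma eq_zero_of_mul_dι {n : ℕ} (f : Module.End ℂ F.Ω) (hd : ∀ a, f (F.d (F.ι a)) = 0)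
    (hf : ∀ m, ∀ ω ∈ F.deg m, ∀ a, f (ω * F.d (F.ι a)) = 0) {x : F.Ω} (hx : x ∈ F.deg (n + 1)) :
    f x = 0 := by
  suffices h : F.deg (n + 1) ≤ LinearMap.ker f from h hx
  cases n with
  | zero =>
    rw [F.deg_one, Submodule.span_le]
    rintro _ (⟨a, rfl⟩ | ⟨a, c, rfl⟩)
    · exact hd a
    · exact hf 0 _ (F.ι_mem a) c
  | succ n =>
    rw [F.deg_succ, Submodule.span_le]
    rintro _ ⟨ω, hω, a, rfl⟩
    exact hf _ ω hω a

/-- A linear map vanishing on all words `w` and all `a w` of length `n + 1` vanishes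
on `Ω^{n+1}`. -/
lemma eq_zero_of_word (n : ℕ) (f : Module.End ℂ F.Ω) (hw : ∀ w, F.IsWord (n + 1) w → f w = 0)
    (haw : ∀ a w, F.IsWord (n + 1) w → f (F.ι a * w) = 0) {x : F.Ω} (hx : x ∈ F.deg (n + 1)) :
    f x = 0 := by
  induction n generalizing f x with
  | zero =>
    suffices h : F.deg 1 ≤ LinearMap.ker f from h hx
    rw [F.deg_one, Submodule.span_le]
    rintro _ (⟨a, rfl⟩ | ⟨a, c, rfl⟩)
    · exact hw _ (.single a)
    · exact haw a _ (.single c)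
  | succ n ih =>
    suffices h : F.deg (n + 2) ≤ LinearMap.ker f from h hx
    rw [F.deg_succ, Submodule.span_le]
    rintro _ ⟨ω, hω, a, rfl⟩
    refine ih (f ∘ₗ LinearMap.mulRight ℂ (F.d (F.ι a))) (fun w h => hw _ (h.snoc a))
      (fun c w h => ?_) hω
    simpa [mul_assoc] using haw c _ (h.snoc a)

/-- A linear map vanishing on every homogeneous form is zero. -/
lemma end_eq_zero (f : Module.End ℂ F.Ω) (hf : ∀ n, ∀ x ∈ F.deg n, f x = 0) : f = 0 := by
  have h : (⨆ n, F.deg n) ≤ LinearMap.ker f := iSup_le fun n x hx => hf n x hx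
  rw [F.internal.submodule_iSup_eq_top] at h
  exact LinearMap.ext fun x => h trivial

/-- The square of the Hochschild boundary is zero. -/
lemma hochschild_mul_self {b : Module.End ℂ F.Ω}
    (hb_zero : ∀ x ∈ F.deg 0, b x = 0)
    (hb_d : ∀ a : A, b (F.d (F.ι a)) = 0)
    (hb_form : ∀ (m : ℕ) (ω : F.Ω), ω ∈ F.deg m → ∀ a : A,
      b (ω * F.d (F.ι a)) = ((-1 : ℂ) ^ m) • (ω * F.ι a - F.ι a * ω)) :
    b * b = 0 := by
  have hcomm (a : A) (m : ℕ) (ω : F.Ω) (hω : ω ∈ F.deg (m + 1)) :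
      b (ω * F.ι a - F.ι a * ω) = 0 := by
    refine eq_zero_of_mul_dι
      (b ∘ₗ (LinearMap.mulRight ℂ (F.ι a) - LinearMap.mulLeft ℂ (F.ι a))) (fun c => ?_)
      (fun k η hη c => ?_) hω
    · have h₁ := hb_form 0 _ (F.ι_mem c) a
      have h₂ := hb_form 0 _ (F.ι_mem a) c
      simp [F.da_mul, hb_d, h₁, h₂]
    · have h₁ := hb_form k _ hη (c * a)
      have h₂ := hb_form k _ (mul_ι_mem hη c) a
      have h₃ := hb_form k _ (ι_mul_mem hη a) c
      simp only [LinearMap.comp_apply, LinearMap.sub_apply, LinearMap.mulRight_apply,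
        LinearMap.mulLeft_apply, mul_assoc, F.da_mul, mul_sub, map_sub, F.ι_mul] at *
      rw [h₁, h₂, h₃, ← smul_sub, ← smul_sub]
      convert smul_zero _
      abel
  refine end_eq_zero _ fun n x hx => ?_
  cases n with
  | zero => simp [hb_zero x hx]
  | succ n =>
    refine eq_zero_of_mul_dι (b * b) (fun a => by simp [hb_d]) (fun m ω hω a => ?_) hx
    rw [Module.End.mul_apply, hb_form m ω hω a, map_smul]
    cases m with
    | zero =>
      rw [hb_zero _ (sub_mem (mul_ι_mem hω a) (ι_mul_mem hω a)), smul_zero]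
    | succ m => rw [hcomm a m ω hω, smul_zero]

/-- The homotopy formula `κ = 1 - (b d + d b)` for the Karoubi operator. -/
lemma karoubi_eq {b κ : Module.End ℂ F.Ω}
    (hb_zero : ∀ x ∈ F.deg 0, b x = 0)
    (hb_d : ∀ a : A, b (F.d (F.ι a)) = 0)
    (hb_form : ∀ (m : ℕ) (ω : F.Ω), ω ∈ F.deg m → ∀ a : A,
      b (ω * F.d (F.ι a)) = ((-1 : ℂ) ^ m) • (ω * F.ι a - F.ι a * ω))
    (hκ_zero : ∀ x ∈ F.deg 0, κ x = x)
    (hκ_d : ∀ a : A, κ (F.d (F.ι a)) = F.d (F.ι a))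
    (hκ_form : ∀ (m : ℕ) (ω : F.Ω), ω ∈ F.deg m → ∀ a : A,
      κ (ω * F.d (F.ι a)) = ((-1 : ℂ) ^ m) • (F.d (F.ι a) * ω)) :
    κ = 1 - (b * F.d + F.d * b) := by
  rw [← sub_eq_zero]
  refine end_eq_zero _ fun n x hx => ?_
  cases n with
  | zero =>
    obtain ⟨a, rfl⟩ : x ∈ LinearMap.range F.ι := F.deg_zero ▸ hx
    simp [hκ_zero _ hx, hb_zero _ hx, hb_d]
  | succ n =>
    refine eq_zero_of_mul_dι (κ - (1 - (b * F.d + F.d * b)))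
      (fun a => by simp [hκ_d, hb_d, F.d_d]) (fun m ω hω a => ?_) hx
    have hsq : ((-1 : ℂ) ^ m) * (-1) ^ m = 1 := by rw [← mul_pow]; simp
    simp only [LinearMap.sub_apply, LinearMap.add_apply, Module.End.mul_apply,
      Module.End.one_apply, d_mul_dι hω, hκ_form m ω hω, hb_form m ω hω,
      hb_form _ _ (F.d_mem hω), map_smul, map_sub, F.leibniz hω, F.leibniz (F.ι_mem a),
      pow_succ, smul_sub, smul_add, smul_smul, hsq]
    simp only [mul_neg, mul_one, neg_smul, pow_zero, one_smul]
    abel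

/-- The Karoubi operator permutes the factors of `ω da₁ ⋯ daₖ` cyclically. -/
lemma karoubi_pow_mul_word {κ : Module.End ℂ F.Ω}
    (hκ_form : ∀ (m : ℕ) (ω : F.Ω), ω ∈ F.deg m → ∀ a : A,
      κ (ω * F.d (F.ι a)) = ((-1 : ℂ) ^ m) • (F.d (F.ι a) * ω))
    {k : ℕ} {w : F.Ω} (hw : F.IsWord k w) {m : ℕ} {ω : F.Ω} (hω : ω ∈ F.deg m) :
    (κ ^ k) (ω * w) = ((-1 : ℂ) ^ (k * (m + k + 1))) • (w * ω) := by
  induction hw generalizing m ω with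
  | single a =>
    rw [pow_one, hκ_form m ω hω]
    simp [pow_add]
  | @snoc k w hw a ih =>
    rw [← mul_assoc, pow_succ, Module.End.mul_apply, hκ_form _ _ (F.mul_mem' hω hw.mem_deg),
      map_smul, ← mul_assoc, ih (dι_mul_mem hω a), smul_smul, ← pow_add, mul_assoc w]
    congr 1
    rw [show (k + 1) * (m + (k + 1) + 1) = m + k + k * (m + 1 + k + 1) + 2 by ring, pow_add _ _ 2]
    simp

/-- A word of length `n` is fixed by `κⁿ`. -/
lemma karoubi_pow_word {κ : Module.End ℂ F.Ω}
    (hκ_d : ∀ a : A, κ (F.d (F.ι a)) = F.d (F.ι a))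
    (hκ_form : ∀ (m : ℕ) (ω : F.Ω), ω ∈ F.deg m → ∀ a : A,
      κ (ω * F.d (F.ι a)) = ((-1 : ℂ) ^ m) • (F.d (F.ι a) * ω))
    {n : ℕ} {w : F.Ω} (hw : F.IsWord n w) : (κ ^ n) w = w := by
  cases hw with
  | single a => simpa using hκ_d a
  | @snoc n w hw a =>
    rw [pow_succ, Module.End.mul_apply, hκ_form n w hw.mem_deg, map_smul,
      karoubi_pow_mul_word hκ_form hw (F.dι_mem a), smul_smul, ← pow_add]
    rw [(show Even (n + n * (1 + n + 1)) by grind).neg_one_pow, one_smul]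

/-- On `dΩⁿ` the Karoubi operator has order dividing `n + 1`. -/
lemma karoubi_pow_d {κ : Module.End ℂ F.Ω}
    (hκ_d : ∀ a : A, κ (F.d (F.ι a)) = F.d (F.ι a))
    (hκ_form : ∀ (m : ℕ) (ω : F.Ω), ω ∈ F.deg m → ∀ a : A,
      κ (ω * F.d (F.ι a)) = ((-1 : ℂ) ^ m) • (F.d (F.ι a) * ω))
    {n : ℕ} {x : F.Ω} (hx : x ∈ F.deg n) : (κ ^ (n + 1)) (F.d x) = F.d x := by
  cases n with
  | zero =>
    obtain ⟨a, rfl⟩ : x ∈ LinearMap.range F.ι := F.deg_zero ▸ hx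
    simpa using hκ_d a
  | succ n =>
    rw [← sub_eq_zero]
    refine eq_zero_of_word n ((κ ^ (n + 1 + 1)) * F.d - F.d) (fun w hw => ?_)
      (fun a w hw => ?_) hx
    · simp [hw.d_eq_zero]
    · rw [LinearMap.sub_apply, Module.End.mul_apply, d_ι_mul_word hw,
        karoubi_pow_word hκ_d hκ_form (hw.dι_mul a), sub_self]

/-- On `Ωⁿ` one has `κⁿ = 1 + b κⁿ d`. -/
lemma karoubi_pow_eq {b κ : Module.End ℂ F.Ω}
    (hb_d : ∀ a : A, b (F.d (F.ι a)) = 0)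
    (hb_form : ∀ (m : ℕ) (ω : F.Ω), ω ∈ F.deg m → ∀ a : A,
      b (ω * F.d (F.ι a)) = ((-1 : ℂ) ^ m) • (ω * F.ι a - F.ι a * ω))
    (hκ_d : ∀ a : A, κ (F.d (F.ι a)) = F.d (F.ι a))
    (hκ_form : ∀ (m : ℕ) (ω : F.Ω), ω ∈ F.deg m → ∀ a : A,
      κ (ω * F.d (F.ι a)) = ((-1 : ℂ) ^ m) • (F.d (F.ι a) * ω))
    {n : ℕ} {x : F.Ω} (hx : x ∈ F.deg n) : (κ ^ n) x = x + b ((κ ^ n) (F.d x)) := by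
  cases n with
  | zero =>
    obtain ⟨a, rfl⟩ : x ∈ LinearMap.range F.ι := F.deg_zero ▸ hx
    simp [hb_d]
  | succ n =>
    rw [← sub_eq_zero]
    refine eq_zero_of_word n (κ ^ (n + 1) - (1 + b * (κ ^ (n + 1) * F.d))) (fun w hw => ?_)
      (fun a w hw => ?_) hx
    · simp [hw.d_eq_zero, karoubi_pow_word hκ_d hκ_form hw]
    · simp only [LinearMap.sub_apply, LinearMap.add_apply, Module.End.mul_apply,
        Module.End.one_apply, d_ι_mul_word hw, karoubi_pow_mul_word hκ_form hw (F.ι_mem a),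
        karoubi_pow_mul_word hκ_form hw (F.dι_mem a), map_smul, hb_form _ _ hw.mem_deg,
        smul_smul, ← pow_add]
      rw [(show Even ((n + 1) * (0 + (n + 1) + 1)) by grind).neg_one_pow,
        (show Even ((n + 1) * (1 + (n + 1) + 1) + (n + 1)) by grind).neg_one_pow, one_smul,
        one_smul]
      abel

end Forms

section PowApply

variable {R M : Type*} [Ring R] [AddCommGroup M] [Module R M] {κ : Module.End R M}

lemma Module.End.pow_mul_add_apply_of_pow_apply_eq {y : M} {n : ℕ} (hy : (κ ^ n) y = y)
    (j i : ℕ) : (κ ^ (n * j + i)) y = (κ ^ i) y := by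
  induction j with
  | zero => simp
  | succ j ih =>
    rw [show n * (j + 1) + i = n * j + i + n by ring, pow_add, Module.End.mul_apply, hy, ih]

lemma Module.End.pow_mul_succ_sub_of_pow_eq_add {b : Module.End R M} (hcomm : Commute κ b) {n : ℕ}
    {x y : M} (hx : (κ ^ n) x = x + b ((κ ^ n) y)) (hy : (κ ^ (n + 1)) y = y) :
    (κ ^ (n * (n + 1))) x - x = b (∑ j ∈ Finset.range (n + 1), (κ ^ j) y) := by
  have key (k : ℕ) :
      (κ ^ (n * k)) x = x + b (∑ j ∈ Finset.range k, (κ ^ (n * (j + 1))) y) := by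
    induction k with
    | zero => simp
    | succ k ih =>
      have h := LinearMap.congr_fun (hcomm.pow_left (n * k)).eq ((κ ^ n) y)
      simp only [Module.End.mul_apply] at h
      rw [mul_add, mul_one, pow_add, Module.End.mul_apply, hx, map_add, ih, h,
        ← Module.End.mul_apply (κ ^ (n * k)), ← pow_add, Finset.sum_range_succ, map_add, add_assoc,
        mul_add, mul_one]
  rw [key, add_sub_cancel_left, ← Finset.sum_range_reflect]
  congr 1
  refine Finset.sum_congr rfl fun j hj => ?_
  have hj : j ≤ n := Nat.lt_succ_iff.mp (Finset.mem_range.mp hj)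
  obtain ⟨i, rfl⟩ := Nat.exists_eq_add_of_le hj
  rw [show j + i + 1 - 1 - j = i by lia, show (j + i) * (i + 1) = (j + i + 1) * i + j by ring,
    Module.End.pow_mul_add_apply_of_pow_apply_eq hy]

lemma Module.End.pow_mul_succ_sub_of_pow_succ_eq_sub {n : ℕ} {x z : M}
    (hx : (κ ^ (n + 1)) x = x - z) (hz : (κ ^ n) z = z) :
    (κ ^ (n * (n + 1))) x - x = -∑ j ∈ Finset.range n, (κ ^ j) z := by
  have key (k : ℕ) : (κ ^ (k * (n + 1))) x = x - ∑ j ∈ Finset.range k, (κ ^ j) z := by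
    induction k with
    | zero => simp
    | succ k ih =>
      rw [add_mul, one_mul, pow_add, Module.End.mul_apply, hx, map_sub, ih,
        show k * (n + 1) = n * k + k by ring, Module.End.pow_mul_add_apply_of_pow_apply_eq hz,
        Finset.sum_range_succ]
      abel
  rw [key]
  abel

end PowApply

/-- With Connes's operator `B = Σ_{j=0}^{n} κ^j ∘ d` on `Ωⁿ A`, one has
`κ^{n(n+1)} − id = b ∘ B = −B ∘ b` on `Ωⁿ A`, `B ∘ B = 0`, and `(B + b)² = 0`; thus
`(Ω A, b, B)` is a bicomplex. -/
theorem connes_B_bicomplex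
    {A : Type} [NonUnitalRing A] [Module ℂ A] [SMulCommClass ℂ A A] [IsScalarTower ℂ A A]
    (F : Forms A) (b κ Bop : Module.End ℂ F.Ω)
    (hb_mem : ∀ (m : ℕ) (x : F.Ω), x ∈ F.deg (m + 1) → b x ∈ F.deg m)
    (hb_zero : ∀ x ∈ F.deg 0, b x = 0)
    (hb_d : ∀ a : A, b (F.d (F.ι a)) = 0)
    (hb_form : ∀ (m : ℕ) (ω : F.Ω), ω ∈ F.deg m → ∀ a : A,
      b (ω * F.d (F.ι a)) = ((-1 : ℂ) ^ m) • (ω * F.ι a - F.ι a * ω))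
    (hκ_mem : ∀ (m : ℕ) (x : F.Ω), x ∈ F.deg m → κ x ∈ F.deg m)
    (hκ_zero : ∀ x ∈ F.deg 0, κ x = x)
    (hκ_d : ∀ a : A, κ (F.d (F.ι a)) = F.d (F.ι a))
    (hκ_form : ∀ (m : ℕ) (ω : F.Ω), ω ∈ F.deg m → ∀ a : A,
      κ (ω * F.d (F.ι a)) = ((-1 : ℂ) ^ m) • (F.d (F.ι a) * ω))
    (hB : ∀ (n : ℕ), ∀ x ∈ F.deg n, Bop x = ∑ j ∈ Finset.range (n + 1), (κ ^ j) (F.d x)) :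
    (∀ (n : ℕ), ∀ x ∈ F.deg n, (κ ^ (n * (n + 1))) x - x = b (Bop x)) ∧
    (∀ (n : ℕ), ∀ x ∈ F.deg n, b (Bop x) = -(Bop (b x))) ∧
    (∀ x : F.Ω, Bop (Bop x) = 0) ∧
    (Bop + b) * (Bop + b) = 0 := by
  have hbb : b * b = 0 := Forms.hochschild_mul_self hb_zero hb_d hb_form
  have hdd : F.d * F.d = 0 := LinearMap.ext F.d_d
  have hκ : κ = 1 - (b * F.d + F.d * b) :=
    Forms.karoubi_eq hb_zero hb_d hb_form hκ_zero hκ_d hκ_form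
  have hκb : Commute κ b := by
    rw [hκ, commute_iff_eq]
    simp only [sub_mul, mul_sub, add_mul, mul_add, mul_assoc, hbb]
    simp only [← mul_assoc, hbb]
    simp
  have hκd : Commute κ F.d := by
    rw [hκ, commute_iff_eq]
    simp only [sub_mul, mul_sub, add_mul, mul_add, mul_assoc, hdd]
    simp only [← mul_assoc, hdd]
    simp
  have hκpow_mem (j n : ℕ) (x : F.Ω) (hx : x ∈ F.deg n) : (κ ^ j) x ∈ F.deg n := by
    induction j with
    | zero => simpa
    | succ j ih =>
      rw [pow_succ', Module.End.mul_apply]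
      exact hκ_mem _ _ ih
  have hbB (n : ℕ) (x : F.Ω) (hx : x ∈ F.deg n) : (κ ^ (n * (n + 1))) x - x = b (Bop x) := by
    rw [hB n x hx]
    exact Module.End.pow_mul_succ_sub_of_pow_eq_add hκb
      (Forms.karoubi_pow_eq hb_d hb_form hκ_d hκ_form hx) (Forms.karoubi_pow_d hκ_d hκ_form hx)
  have hanti (n : ℕ) (x : F.Ω) (hx : x ∈ F.deg n) : b (Bop x) = -(Bop (b x)) := by
    rw [← hbB n x hx]
    cases n with
    | zero => simp [hb_zero x hx]
    | succ n =>
      have hbx := hb_mem n x hx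
      rw [hB n _ hbx]
      refine Module.End.pow_mul_succ_sub_of_pow_succ_eq_sub ?_
        (Forms.karoubi_pow_d hκ_d hκ_form hbx)
      have h := LinearMap.congr_fun hκb.eq ((κ ^ (n + 1)) (F.d x))
      simp only [Module.End.mul_apply] at h
      rw [pow_succ', Module.End.mul_apply,
        Forms.karoubi_pow_eq hb_d hb_form hκ_d hκ_form hx, map_add, h,
        ← Module.End.mul_apply κ, ← pow_succ', Forms.karoubi_pow_d hκ_d hκ_form hx, hκ]
      simp only [LinearMap.sub_apply, LinearMap.add_apply, Module.End.mul_apply,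
        Module.End.one_apply]
      abel
  have hBB : Bop * Bop = 0 := by
    refine Forms.end_eq_zero _ fun n x hx => ?_
    have hmem : Bop x ∈ F.deg (n + 1) := by
      rw [hB n x hx]
      exact sum_mem fun j _ => hκpow_mem j _ _ (F.d_mem hx)
    have hdB : F.d (Bop x) = 0 := by
      rw [hB n x hx, map_sum]
      refine Finset.sum_eq_zero fun j _ => ?_
      rw [← Module.End.mul_apply, ← (hκd.pow_left j).eq, Module.End.mul_apply, F.d_d, map_zero]
    rw [Module.End.mul_apply, hB _ _ hmem, hdB]
    simp
  have hsum : b * Bop + Bop * b = 0 :=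
    Forms.end_eq_zero _ fun n x hx => by simp [hanti n x hx]
  refine ⟨hbB, hanti, LinearMap.congr_fun hBB, ?_⟩
  rw [add_mul, mul_add, mul_add, hBB, hbb, zero_add, add_zero, add_comm, hsum]
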